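/- (Optimality Claim, part 2) The Liveness Theorem fails if D_close is replaced by a smaller constant: for all positive reals d_min, d_max, d_open, d_close with d_close < d_min ≤ d_max, and for every constant c with 0 < c < D_close, there exist a regular run with a single track and reals α, β with 0 ≤ α and α + d_open < β − c such that TrackStatus(x,t) ≠ incrossing for the track x and all t ∈ (α,β), yet GateStatus(t) = closed for some t ∈ [α + d_open, β − c]. -/

import Mathlib

namespace RailCross

inductive TStat : Type
  | emp | coming | incrossing
deriving DecidableEq

inductive DirV : Type
  | opn | cls
deriving DecidableEq

inductive GateV : Type
  | opened | closed
deriving DecidableEq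

/-- `f` is piecewise constant on `[0, ∞)`: for every `τ > 0` there is a finite
partition `0 = s 0 < s 1 < … < s n = τ` such that `f` is constant on each open
subinterval `(s i, s (i+1))`. -/
def PWC {Y : Type*} (f : ℝ → Y) : Prop :=
  ∀ τ : ℝ, 0 < τ → ∃ n : ℕ, ∃ s : ℕ → ℝ,
    s 0 = 0 ∧ s n = τ ∧ (∀ i < n, s i < s (i + 1)) ∧
    (∀ i < n, ∀ a b : ℝ, s i < a → a < b → b < s (i + 1) → f a = f b)

/-- `v` is the right-hand value `f(t+)`: `f` is constantly `v` on some `(t, t+ε)`. -/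
def RightVal {Y : Type*} (f : ℝ → Y) (t : ℝ) (v : Y) : Prop :=
  ∃ ε : ℝ, 0 < ε ∧ ∀ u : ℝ, t < u → u < t + ε → f u = v

/-- `v` is the left-hand value `f(t−)` (for `t > 0`): `f` is constantly `v` on some `(t-ε, t)`. -/
def LeftVal {Y : Type*} (f : ℝ → Y) (t : ℝ) (v : Y) : Prop :=
  ∃ ε : ℝ, 0 < ε ∧ ε ≤ t ∧ ∀ u : ℝ, t - ε < u → u < t → f u = v

/-- `tm` is the (finite or infinite) increasing sequence of significant moments of a
track with status function `f`; a finite sequence is encoded by letting `tm` take the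
value `⊤ = ∞` from some point on. -/
structure TrainMotion (dmin dmax : ℝ) (f : ℝ → TStat) (tm : ℕ → EReal) : Prop where
  zero : tm 0 = 0
  mono : Monotone tm
  strict : ∀ i, tm i ≠ ⊤ → tm i < tm (i + 1)
  last_div : ∀ k, tm k ≠ ⊤ → tm (k + 1) = ⊤ → 3 ∣ k
  status_empty : ∀ i : ℕ, ∀ u : ℝ, tm (3 * i) ≤ (u : EReal) → (u : EReal) < tm (3 * i + 1) →
    f u = TStat.emp
  status_coming : ∀ i : ℕ, ∀ u : ℝ, tm (3 * i + 1) ≤ (u : EReal) → (u : EReal) < tm (3 * i + 2) →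
    f u = TStat.coming
  status_cross : ∀ i : ℕ, ∀ u : ℝ, tm (3 * i + 2) ≤ (u : EReal) → (u : EReal) < tm (3 * i + 3) →
    f u = TStat.incrossing
  gap : ∀ i : ℕ, ∀ a b : ℝ, tm (3 * i + 1) = (a : EReal) → tm (3 * i + 2) = (b : EReal) →
    dmin ≤ b - a ∧ b - a ≤ dmax

/-- `SafeToOpen(t)`: every track is empty or its deadline is more than `dopen` away. -/
def SafeToOpen {Tracks : Type*} (dopen : ℝ) (trackStatus : Tracks → ℝ → TStat)
    (deadline : Tracks → ℝ → EReal) (t : ℝ) : Prop :=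
  ∀ x : Tracks, trackStatus x t = TStat.emp ∨ ((t + dopen : ℝ) : EReal) < deadline x t

/-- A regular run of the railroad-crossing evolving algebra.  `WaitTime = dmin - dclose`. -/
structure RegularRun (Tracks : Type*) (dmin dmax dopen dclose : ℝ) where
  trackStatus : Tracks → ℝ → TStat
  deadline : Tracks → ℝ → EReal
  dir : ℝ → DirV
  gate : ℝ → GateV
  /-- the right-hand value `Deadline(x, t+)` -/
  deadlinePlus : Tracks → ℝ → EReal
  /-- the right-hand value `Dir(t+)` -/
  dirPlus : ℝ → DirV
  /-- the right-hand value `GateStatus(t+)` -/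
  gatePlus : ℝ → GateV
  pwc_ts : ∀ x, PWC (trackStatus x)
  pwc_dl : ∀ x, PWC (deadline x)
  pwc_dir : PWC dir
  pwc_gate : PWC gate
  dlPlus_spec : ∀ x, ∀ t : ℝ, 0 ≤ t → RightVal (deadline x) t (deadlinePlus x t)
  dirPlus_spec : ∀ t : ℝ, 0 ≤ t → RightVal dir t (dirPlus t)
  gatePlus_spec : ∀ t : ℝ, 0 ≤ t → RightVal gate t (gatePlus t)
  dl_left : ∀ x, ∀ t : ℝ, 0 < t → LeftVal (deadline x) t (deadline x t)
  dir_left : ∀ t : ℝ, 0 < t → LeftVal dir t (dir t)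
  gate_left : ∀ t : ℝ, 0 < t → LeftVal gate t (gate t)
  trainMotion : ∀ x, ∃ tm : ℕ → EReal, TrainMotion dmin dmax (trackStatus x) tm
  dl_init : ∀ x, deadline x 0 = ⊤
  dir_init : dir 0 = DirV.opn
  gate_init : gate 0 = GateV.opened
  dl_step_coming : ∀ x, ∀ t : ℝ, 0 ≤ t → trackStatus x t = TStat.coming → deadline x t = ⊤ →
    deadlinePlus x t = ((t + (dmin - dclose) : ℝ) : EReal)
  dl_step_empty : ∀ x, ∀ t : ℝ, 0 ≤ t → trackStatus x t = TStat.emp → deadline x t ≠ ⊤ →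
    deadlinePlus x t = ⊤
  dl_step_other : ∀ x, ∀ t : ℝ, 0 ≤ t →
    ¬(trackStatus x t = TStat.coming ∧ deadline x t = ⊤) →
    ¬(trackStatus x t = TStat.emp ∧ deadline x t ≠ ⊤) →
    deadlinePlus x t = deadline x t
  dir_step_close : ∀ t : ℝ, 0 ≤ t → (∃ x, deadline x t = (t : EReal)) → dirPlus t = DirV.cls
  dir_step_open : ∀ t : ℝ, 0 ≤ t → (∀ x, deadline x t ≠ (t : EReal)) → dir t = DirV.cls →
    SafeToOpen dopen trackStatus deadline t → dirPlus t = DirV.opn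
  dir_step_other : ∀ t : ℝ, 0 ≤ t → (∀ x, deadline x t ≠ (t : EReal)) →
    ¬(dir t = DirV.cls ∧ SafeToOpen dopen trackStatus deadline t) → dirPlus t = dir t
  gate_step : ∀ t : ℝ, 0 ≤ t →
    gatePlus t = gate t ∨ (dir t = DirV.opn ∧ gatePlus t = GateV.opened) ∨
      (dir t = DirV.cls ∧ gatePlus t = GateV.closed)
  gate_close_bound : ∀ t : ℝ, 0 ≤ t →
    ¬(∀ u ∈ Set.Ioo t (t + dclose), dir u = DirV.cls ∧ gate u = GateV.opened)
  gate_open_bound : ∀ t : ℝ, 0 ≤ t →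
    ¬(∀ u ∈ Set.Ioo t (t + dopen), dir u = DirV.opn ∧ gate u = GateV.closed)

/-- The left-continuous step function with value `x` up to `p`, then `y` up to `q`, then `z`. -/
noncomputable def leftStep {Y : Type*} (p q : ℝ) (x y z : Y) (u : ℝ) : Y :=
  if u ≤ p then x else if u ≤ q then y else z

/-- The right-continuous step function with value `x` before `p`, then `y` before `q`, then `z`. -/
noncomputable def rightStep {Y : Type*} (p q : ℝ) (x y z : Y) (u : ℝ) : Y :=
  if u < p then x else if u < q then y else z

/-- The status of a track on which a single train is coming on `[p, q)` and in the crossing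
on `[q, r)`. -/
noncomputable def singleTrain (p q r : ℝ) (u : ℝ) : TStat :=
  if u < p then TStat.emp else if u < q then TStat.coming else
    if u < r then TStat.incrossing else TStat.emp

theorem PWC.of_strictMono {Y : Type*} {f : ℝ → Y} {s : ℕ → ℝ} (h0 : s 0 = 0) (hs : StrictMono s)
    (hub : ∀ τ, ∃ n, τ ≤ s n)
    (hf : ∀ i a b, s i < a → a < b → b < s (i + 1) → f a = f b) : PWC f := by
  classical
  intro τ hτ
  set n := Nat.find (hub τ)
  have hτn : τ ≤ s n := Nat.find_spec (hub τ)
  have hlt : ∀ i < n, s i < τ := fun i hi => not_le.1 (Nat.find_min (hub τ) hi)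
  have hnpos : 0 < n := by
    rcases Nat.eq_zero_or_pos n with h | h
    · rw [h, h0] at hτn
      linarith
    · exact h
  refine ⟨n, fun i => if i < n then s i else τ, by simp [hnpos, h0], by simp, ?_, ?_⟩
  · intro i hi
    by_cases h : i + 1 < n
    · simpa [hi, h] using hs (Nat.lt_succ_self i)
    · simpa [hi, h] using hlt i hi
  · intro i hi a b ha hab hb
    simp only [hi, if_true] at ha
    refine hf i a b ha hab ?_
    by_cases h : i + 1 < n
    · simpa [h] using hb
    · have : i + 1 = n := by omega
      simp only [h, if_false] at hb
      rw [this]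
      linarith

theorem PWC.of_three_breaks {Y : Type*} {f : ℝ → Y} {p q r : ℝ} {w x y z : Y}
    (hp : 0 < p) (hpq : p < q) (hqr : q < r)
    (h₀ : ∀ u, u < p → f u = w) (h₁ : ∀ u, p < u → u < q → f u = x)
    (h₂ : ∀ u, q < u → u < r → f u = y) (h₃ : ∀ u, r < u → f u = z) : PWC f := by
  refine PWC.of_strictMono (s := fun i => match i with
    | 0 => 0 | 1 => p | 2 => q | k + 3 => r + k) rfl (strictMono_nat_of_lt_succ ?_) ?_ ?_
  · rintro (_ | _ | _ | k) <;> simp [hp, hpq, hqr]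
  · intro τ
    obtain ⟨n, hn⟩ := exists_nat_ge (τ - r)
    exact ⟨n + 3, by simp only; linarith⟩
  · rintro (_ | _ | _ | k) a b ha hab hb
    · exact (h₀ a (hab.trans hb)).trans (h₀ b hb).symm
    · exact (h₁ a ha (hab.trans hb)).trans (h₁ b (ha.trans hab) hb).symm
    · have hb' : b < r := by simpa using hb
      exact (h₂ a ha (hab.trans hb')).trans (h₂ b (ha.trans hab) hb').symm
    · have hk : (0 : ℝ) ≤ k := k.cast_nonneg
      have ha' : r + k < a := ha
      rw [h₃ a (by linarith), h₃ b (by linarith)]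

theorem PWC.leftStep {Y : Type*} {p q : ℝ} {x y z : Y} (hp : 0 < p) (hpq : p < q) :
    PWC (leftStep p q x y z) := by
  refine PWC.of_three_breaks (r := q + 1) (w := x) (x := y) (y := z) (z := z) hp hpq
    (by linarith) ?_ ?_ ?_ ?_ <;> intros <;> unfold RailCross.leftStep <;> split_ifs <;>
    first | rfl | (exfalso; linarith)

theorem PWC.singleTrain {p q r : ℝ} (hp : 0 < p) (hpq : p < q) (hqr : q < r) :
    PWC (singleTrain p q r) := by
  refine PWC.of_three_breaks (w := TStat.emp) (x := TStat.coming) (y := TStat.incrossing)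
    (z := TStat.emp) hp hpq hqr ?_ ?_ ?_ ?_ <;> intros <;> unfold RailCross.singleTrain <;>
    split_ifs <;> first | rfl | (exfalso; linarith)

theorem rightVal_leftStep {Y : Type*} {p q : ℝ} {x y z : Y} (hpq : p < q) (t : ℝ) :
    RightVal (leftStep p q x y z) t (rightStep p q x y z t) := by
  rcases lt_or_ge t p with h | h
  · refine ⟨p - t, by linarith, fun u hu hu' => ?_⟩
    rw [leftStep, rightStep, if_pos h, if_pos (by linarith)]
  · rcases lt_or_ge t q with h' | h'
    · refine ⟨q - t, by linarith, fun u hu hu' => ?_⟩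
      rw [leftStep, rightStep, if_neg (by linarith), if_pos (by linarith), if_neg (by linarith),
        if_pos (by linarith)]
    · refine ⟨1, by linarith, fun u hu hu' => ?_⟩
      rw [leftStep, rightStep, if_neg (by linarith), if_neg (by linarith), if_neg (by linarith),
        if_neg (by linarith)]

theorem leftVal_leftStep {Y : Type*} {p q : ℝ} {x y z : Y} (hp : 0 < p) (hpq : p < q) {t : ℝ}
    (ht : 0 < t) : LeftVal (leftStep p q x y z) t (leftStep p q x y z t) := by
  rcases le_or_gt t p with h | h
  · refine ⟨t, ht, le_rfl, fun u hu hu' => ?_⟩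
    rw [leftStep, leftStep, if_pos h, if_pos (by linarith)]
  · rcases le_or_gt t q with h' | h'
    · refine ⟨t - p, by linarith, by linarith, fun u hu hu' => ?_⟩
      rw [leftStep, leftStep, if_neg (by linarith), if_pos (by linarith), if_neg (by linarith),
        if_pos (by linarith)]
    · refine ⟨t - q, by linarith, by linarith, fun u hu hu' => ?_⟩
      rw [leftStep, leftStep, if_neg (by linarith), if_neg (by linarith), if_neg (by linarith),
        if_neg (by linarith)]

theorem trainMotion_singleTrain {dmin dmax p q r : ℝ} (hp : 0 < p) (hpq : p < q) (hqr : q < r)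
    (hmin : dmin ≤ q - p) (hmax : q - p ≤ dmax) :
    TrainMotion dmin dmax (singleTrain p q r) (fun i => match i with
      | 0 => 0 | 1 => (p : EReal) | 2 => (q : EReal) | 3 => (r : EReal) | _ + 4 => ⊤) where
  zero := rfl
  mono := by
    refine monotone_nat_of_le_succ ?_
    rintro (_ | _ | _ | _ | k)
    · exact EReal.coe_le_coe_iff.2 hp.le
    · exact EReal.coe_le_coe_iff.2 hpq.le
    · exact EReal.coe_le_coe_iff.2 hqr.le
    · exact le_top
    · exact le_top
  strict := by
    rintro (_ | _ | _ | _ | k) h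
    · exact EReal.coe_lt_coe_iff.2 hp
    · exact EReal.coe_lt_coe_iff.2 hpq
    · exact EReal.coe_lt_coe_iff.2 hqr
    · exact EReal.coe_lt_top r
    · exact absurd rfl h
  last_div := by
    rintro (_ | _ | _ | _ | k) h h'
    · exact absurd h' (EReal.coe_ne_top p)
    · exact absurd h' (EReal.coe_ne_top q)
    · exact absurd h' (EReal.coe_ne_top r)
    · exact dvd_rfl
    · exact absurd rfl h
  status_empty := by
    rintro (_ | _ | k) u h h'
    · have : u < p := EReal.coe_lt_coe_iff.1 h'
      rw [singleTrain, if_pos this]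
    · have : r ≤ u := EReal.coe_le_coe_iff.1 h
      rw [singleTrain, if_neg (by linarith), if_neg (by linarith), if_neg (by linarith)]
    · exact absurd h (not_le.2 (EReal.coe_lt_top u))
  status_coming := by
    rintro (_ | k) u h h'
    · have h₁ : p ≤ u := EReal.coe_le_coe_iff.1 h
      have h₂ : u < q := EReal.coe_lt_coe_iff.1 h'
      rw [singleTrain, if_neg (by linarith), if_pos h₂]
    · exact absurd h (not_le.2 (EReal.coe_lt_top u))
  status_cross := by
    rintro (_ | k) u h h'
    · have h₁ : q ≤ u := EReal.coe_le_coe_iff.1 h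
      have h₂ : u < r := EReal.coe_lt_coe_iff.1 h'
      rw [singleTrain, if_neg (by linarith), if_neg (by linarith), if_pos h₂]
    · exact absurd h (not_le.2 (EReal.coe_lt_top u))
  gap := by
    rintro (_ | k) a b h h'
    · have h₁ : p = a := EReal.coe_eq_coe_iff.1 h
      have h₂ : q = b := EReal.coe_eq_coe_iff.1 h'
      subst h₁ h₂
      exact ⟨hmin, hmax⟩
    · exact absurd h.symm (EReal.coe_ne_top a)

/-- The run with a single train, coming at `p`, entering the crossing at `q` and leaving it at `r`;
`d` is its deadline, and the gate is closed exactly from `g` (excluded) to `g'` (included). -/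
noncomputable def singleTrainRun {dmin dmax dopen dclose p q r d g g' : ℝ} (hopen : 0 < dopen)
    (hp : 0 < p) (hpd : p < d) (hd : d = p + (dmin - dclose)) (hdg : d < g)
    (hgc : g < d + dclose) (hgq : g < q) (hqr : q < r) (hrg : r < g') (hgo : g' < r + dopen)
    (hmin : dmin ≤ q - p) (hmax : q - p ≤ dmax) :
    RegularRun Unit dmin dmax dopen dclose where
  trackStatus _ := singleTrain p q r
  deadline _ := leftStep p r ⊤ (d : EReal) ⊤
  dir := leftStep d r DirV.opn DirV.cls DirV.opn
  gate := leftStep g g' GateV.opened GateV.closed GateV.opened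
  deadlinePlus _ := rightStep p r ⊤ (d : EReal) ⊤
  dirPlus := rightStep d r DirV.opn DirV.cls DirV.opn
  gatePlus := rightStep g g' GateV.opened GateV.closed GateV.opened
  pwc_ts _ := PWC.singleTrain hp (by linarith) hqr
  pwc_dl _ := PWC.leftStep hp (by linarith)
  pwc_dir := PWC.leftStep (by linarith) (by linarith)
  pwc_gate := PWC.leftStep (by linarith) (by linarith)
  dlPlus_spec _ t _ := rightVal_leftStep (by linarith) t
  dirPlus_spec t _ := rightVal_leftStep (by linarith) t
  gatePlus_spec t _ := rightVal_leftStep (by linarith) t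
  dl_left _ _ ht := leftVal_leftStep hp (by linarith) ht
  dir_left _ ht := leftVal_leftStep (by linarith) (by linarith) ht
  gate_left _ ht := leftVal_leftStep (by linarith) (by linarith) ht
  trainMotion _ := ⟨_, trainMotion_singleTrain hp (by linarith) hqr hmin hmax⟩
  dl_init _ := if_pos hp.le
  dir_init := if_pos (by linarith)
  gate_init := if_pos (by linarith)
  dl_step_coming := by
    intro _ t _ h₁ h₂
    unfold singleTrain at h₁
    unfold leftStep at h₂
    unfold rightStep
    split_ifs at h₁ h₂ ⊢ <;> first
      | (exfalso; linarith)
      | exact absurd h₂ (EReal.coe_ne_top d)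
      | (have : t = p := by linarith
         rw [this, hd])
  dl_step_empty := by
    intro _ t _ h₁ h₂
    unfold singleTrain at h₁
    unfold leftStep at h₂
    unfold rightStep
    split_ifs at h₁ h₂ ⊢ <;> rfl
  dl_step_other := by
    intro _ t _ h₁ h₂
    simp only [singleTrain, leftStep, rightStep] at h₁ h₂ ⊢
    split_ifs <;> first
      | rfl
      | (exfalso; linarith)
      | (refine absurd ⟨?_, ?_⟩ h₁
         · rw [if_neg (by linarith), if_pos (by linarith)]
         · rw [if_pos (by linarith)])
      | (refine absurd ⟨?_, ?_⟩ h₂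
         · rw [if_neg (by linarith), if_neg (by linarith), if_neg (by linarith)]
         · rw [if_neg (by linarith), if_pos (by linarith)]
           exact EReal.coe_ne_top d)
  dir_step_close := by
    rintro t _ ⟨_, h⟩
    unfold leftStep at h
    split_ifs at h
    · exact absurd h.symm (EReal.coe_ne_top t)
    · have : d = t := EReal.coe_eq_coe_iff.1 h
      rw [rightStep, if_neg (by linarith), if_pos (by linarith)]
    · exact absurd h.symm (EReal.coe_ne_top t)
  dir_step_open := by
    intro t _ _ h₂ h₃
    have h₃ := h₃ ()
    simp only [singleTrain, leftStep, rightStep] at h₂ h₃ ⊢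
    split_ifs at h₂ ⊢ with h₄ h₅ h₆
    · rfl
    · rcases h₃ with h₃ | h₃
      · split_ifs at h₃
        linarith
      · rw [if_neg (by linarith), if_pos (by linarith), EReal.coe_lt_coe_iff] at h₃
        linarith
    · rfl
  dir_step_other := by
    intro t _ h₁ h₂
    have h₁ := h₁ ()
    simp only [leftStep, rightStep] at h₁ h₂ ⊢
    split_ifs at h₁ h₂ ⊢ with h₃ h₄ h₅ <;> first
      | rfl
      | (exfalso; linarith)
      | (exact absurd (congrArg _ (by linarith : d = t)) h₁)
      | (refine absurd ⟨rfl, fun _ => Or.inl ?_⟩ h₂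
         change singleTrain p q r t = _
         rw [singleTrain, if_neg (by linarith), if_neg (by linarith), if_neg (by linarith)])
  gate_step := by
    intro t _
    simp only [leftStep, rightStep]
    split_ifs <;> first
      | exact Or.inl rfl
      | exact Or.inr (Or.inl ⟨rfl, rfl⟩)
      | exact Or.inr (Or.inr ⟨rfl, rfl⟩)
      | (exfalso; linarith)
  gate_close_bound := by
    intro t _ h
    have key : ∀ u ∈ Set.Ioo t (t + dclose), d < u ∧ u ≤ g := by
      intro u hu
      obtain ⟨h₁, h₂⟩ := h u hu
      unfold leftStep at h₁ h₂
      split_ifs at h₁ h₂ <;> exact ⟨by linarith, by linarith⟩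
    have hc : g - d < dclose := by linarith
    have k₁ := key (t + (dclose - (g - d)) / 3) ⟨by linarith, by linarith⟩
    have k₂ := key (t + dclose - (dclose - (g - d)) / 3) ⟨by linarith, by linarith⟩
    linarith [k₁.1, k₂.2]
  gate_open_bound := by
    intro t _ h
    have key : ∀ u ∈ Set.Ioo t (t + dopen), r < u ∧ u ≤ g' := by
      intro u hu
      obtain ⟨h₁, h₂⟩ := h u hu
      unfold leftStep at h₁ h₂
      split_ifs at h₁ h₂ <;> exact ⟨by linarith, by linarith⟩
    have k₁ := key (t + (dopen - (g' - r)) / 3) ⟨by linarith, by linarith⟩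
    have k₂ := key (t + dopen - (dopen - (g' - r)) / 3) ⟨by linarith, by linarith⟩
    linarith [k₁.1, k₂.2]

theorem optimality_claim_part2
    (dmin dmax dopen dclose : ℝ)
    (hdmin : 0 < dmin) (hdmax : 0 < dmax) (hdopen : 0 < dopen) (hdclose : 0 < dclose)
    (hcm : dclose < dmin) (hmm : dmin ≤ dmax)
    (c : ℝ) (hc0 : 0 < c) (hc : c < dclose + (dmax - dmin)) :
    ∃ R : RegularRun Unit dmin dmax dopen dclose, ∃ α β : ℝ,
      0 ≤ α ∧ α + dopen < β - c ∧
      (∀ t ∈ Set.Ioo α β, R.trackStatus () t ≠ TStat.incrossing) ∧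
      ∃ t ∈ Set.Icc (α + dopen) (β - c), R.gate t = GateV.closed := by
  obtain ⟨δ, hδ, hδ'⟩ : ∃ δ, 0 < δ ∧ δ < min dclose (dclose + (dmax - dmin) - c) :=
    exists_between (lt_min hdclose (by linarith))
  obtain ⟨hδc, hδm⟩ := lt_min_iff.1 hδ'
  refine ⟨singleTrainRun (p := dopen + c) (q := dopen + c + dmax) (r := dopen + c + dmax + 1)
    (d := dopen + c + (dmin - dclose)) (g := dopen + c + (dmin - dclose) + δ)
    (g' := dopen + c + dmax + 1 + dopen / 2) hdopen (by linarith) (by linarith) rfl (by linarith)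
    (by linarith) (by linarith) (by linarith) (by linarith) (by linarith) (by linarith)
    (by linarith), 0, dopen + c + dmax, le_rfl, by linarith, ?_, dopen + c + dmax - c,
    ⟨by linarith, le_rfl⟩, ?_⟩
  · rintro t ⟨-, ht⟩
    simp only [singleTrainRun, singleTrain, ht, if_true]
    split_ifs <;> simp
  · simp only [singleTrainRun, leftStep]
    rw [if_neg (by linarith), if_pos (by linarith)]

end RailCross
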